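/- Let X be a set, γ > 0, and let F be a set of functions X → ℝ. Suppose S is a finite-dimensional linear subspace of functions X → ℝ with dim S = n that γ-approximates F in the sup norm: for every f ∈ F there exists g ∈ S with |f(x) − g(x)| < γ for all x ∈ X. Then the γ-fat-shattering dimension of F is at most n + 1: for any m points x₁, …, x_m ∈ X and any thresholds s₁, …, s_m ∈ ℝ, if for every sign assignment σ : {1, …, m} → {−1, +1} there exists f ∈ F with f(x_i) > s_i + γ when σ_i = +1 and f(x_i) < s_i − γ when σ_i = −1, then m ≤ n + 1. -/

import Mathlib

/-- If a linear subspace `S` of functions realizes every sign pattern of `g (x i) - s i`, then the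
number of points is at most `dim S`. -/
theorem card_le_finrank_of_forall_sign {X ι : Type*} [Fintype ι] (S : Submodule ℝ (X → ℝ))
    [FiniteDimensional ℝ S] (x : ι → X) (s : ι → ℝ)
    (h : ∀ σ : ι → ℝ, (∀ i, σ i = 1 ∨ σ i = -1) → ∃ g ∈ S, ∀ i, 0 < σ i * (g (x i) - s i)) :
    Fintype.card ι ≤ Module.finrank ℝ S := by
  have hli : LinearIndependent ℝ
      (fun i => (LinearMap.proj (x i) : (X → ℝ) →ₗ[ℝ] ℝ).comp S.subtype) := by
    by_contra hdep
    obtain ⟨c, hc, j, hj⟩ := Fintype.not_linearIndependent_iff.mp hdep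
    have hann : ∀ g ∈ S, ∑ i, c i * g (x i) = 0 := fun g hg => by
      simpa using LinearMap.congr_fun hc ⟨g, hg⟩
    have key : ∀ a : ι → ℝ, a j ≠ 0 → (∀ g ∈ S, ∑ i, a i * g (x i) = 0) →
        ∑ i, a i * s i < 0 := by
      intro a haj ha
      obtain ⟨g, hgS, hg⟩ := h (fun i => if 0 ≤ a i then 1 else -1) fun i => by
        by_cases hi : 0 ≤ a i <;> simp [hi]
      have hterm : ∀ i, 0 ≤ a i * (g (x i) - s i) ∧ (a i ≠ 0 → 0 < a i * (g (x i) - s i)) := by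
        intro i
        have hi := hg i
        rcases lt_trichotomy (a i) 0 with hneg | hzero | hpos
        · rw [if_neg hneg.not_ge] at hi
          have := mul_pos_of_neg_of_neg hneg (by linarith : g (x i) - s i < 0)
          exact ⟨this.le, fun _ => this⟩
        · simp [hzero]
        · rw [if_pos hpos.le] at hi
          have := mul_pos hpos (by linarith : 0 < g (x i) - s i)
          exact ⟨this.le, fun _ => this⟩
      have hsum : 0 < ∑ i, a i * (g (x i) - s i) :=
        Finset.sum_pos' (fun i _ => (hterm i).1) ⟨j, Finset.mem_univ j, (hterm j).2 haj⟩
      simp only [mul_sub, Finset.sum_sub_distrib, ha g hgS] at hsum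
      linarith
    have h₁ := key c hj hann
    have h₂ := key (fun i => -c i) (neg_ne_zero.mpr hj) fun g hg => by
      simp [hann g hg]
    simp only [neg_mul, Finset.sum_neg_distrib] at h₂
    linarith
  simpa using hli.fintype_card_le_finrank.trans_eq Subspace.dual_finrank_eq


/-- If a finite-dimensional subspace `S` of functions `X → ℝ` with `dim S = n`
`γ`-approximates a function class `F` in sup norm, then the `γ`-fat-shattering dimension of
`F` is at most `n + 1`: any set of `m` points `γ`-shattered by `F` (with some thresholds)
satisfies `m ≤ n + 1`. -/
theorem stmt_9 {X : Type*} (γ : ℝ) (hγ : 0 < γ) (F : Set (X → ℝ))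
    (S : Submodule ℝ (X → ℝ)) [FiniteDimensional ℝ S] (n : ℕ) (hn : Module.finrank ℝ S = n)
    (happrox : ∀ f ∈ F, ∃ g ∈ S, ∀ x : X, |f x - g x| < γ)
    (m : ℕ) (x : Fin m → X) (s : Fin m → ℝ)
    (hshatter : ∀ σ : Fin m → ℝ, (∀ i, σ i = 1 ∨ σ i = -1) →
      ∃ f ∈ F, ∀ i, (σ i = 1 → s i + γ < f (x i)) ∧ (σ i = -1 → f (x i) < s i - γ)) :
    m ≤ n + 1 := by
  have hcard := card_le_finrank_of_forall_sign S x s fun σ hσ => by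
    obtain ⟨f, hf, hfσ⟩ := hshatter σ hσ
    obtain ⟨g, hg, hfg⟩ := happrox f hf
    refine ⟨g, hg, fun i => ?_⟩
    have habs := abs_lt.mp (hfg (x i))
    rcases hσ i with hi | hi
    · have := (hfσ i).1 hi
      rw [hi]
      linarith [habs.2]
    · have := (hfσ i).2 hi
      rw [hi]
      linarith [habs.1]
  rw [Fintype.card_fin, hn] at hcard
  exact hcard.trans n.le_succ
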